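/- Principal angle bound between signal subspaces (Wedin application): Let A ∈ ℂ^{(M+1)×S} with M ≥ S be a Vandermonde matrix with distinct unit-modulus nodes (entries [A]_{k,i} = exp(i2π(k−1)ω_i) with ω₁,…,ω_S ∈ [0,1) distinct), let P = diag(p₁,…,p_S) with p_i > 0, σ² ≥ 0, and T = A P Aᴴ + σ²I. Let T̂ be Hermitian with E = T − T̂, and suppose σ_S(T) ≥ 2‖E‖₂ and β := p_min σ_S(A)² − σ² > 0. Let U and Û be matrices with orthonormal columns spanning the eigenspaces of the S largest eigenvalues of T and T̂, respectively, and let ψ_S be the largest principal angle between their column spans, i.e., cos(ψ_S) = σ_S(Uᴴ Û). Then sin(ψ_S) ≤ 2‖E‖₂/β. -/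

import Mathlib

open Matrix

noncomputable section

/-- Spectral norm (largest singular value) of a complex matrix. -/
def specNorm {m n : ℕ} (A : Matrix (Fin m) (Fin n) ℂ) : ℝ :=
  ‖LinearMap.toContinuousLinearMap (Matrix.toEuclideanLin A)‖

/-- `k`-th largest singular value (Courant–Fischer min-max characterization). -/
def sval {m n : ℕ} (A : Matrix (Fin m) (Fin n) ℂ) (k : ℕ) : ℝ :=
  sSup {r : ℝ | 0 ≤ r ∧ ∃ V : Submodule ℂ (EuclideanSpace ℂ (Fin n)),
    Module.finrank ℂ V = k ∧ ∀ x ∈ V, r * ‖x‖ ≤ ‖Matrix.toEuclideanLin A x‖}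

/-- Vandermonde matrix with unit-modulus nodes: entries `e^{i2π(k−1)ω_i}`. -/
def vandermonde (K S : ℕ) (ω : Fin S → ℝ) : Matrix (Fin K) (Fin S) ℂ :=
  Matrix.of fun m n => Complex.exp (Complex.I * (2 * Real.pi * (m : ℕ) * ω n))

/-- `U` has orthonormal columns which are eigenvectors of `T` spanning the eigenspace of the
`S` largest eigenvalues of `T`. -/
def IsTopEigenbasis {N S : ℕ} (T : Matrix (Fin N) (Fin N) ℂ) (U : Matrix (Fin N) (Fin S) ℂ) :
    Prop :=
  Uᴴ * U = 1 ∧ ∃ μ : Fin S → ℝ,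
    T * U = U * Matrix.diagonal (fun i => (μ i : ℂ)) ∧
    ∀ (ν : ℝ) (v : Fin N → ℂ), v ≠ 0 → T.mulVec v = (ν : ℂ) • v →
      Uᴴ.mulVec v = 0 → ∀ i, ν ≤ μ i

end


section Helpers
open scoped Matrix.Norms.L2Operator ComplexOrder

lemma pab_specNorm_eq {m n : ℕ} (A : Matrix (Fin m) (Fin n) ℂ) : specNorm A = ‖A‖ := rfl

lemma pab_normsq {m n : ℕ} (B : Matrix (Fin m) (Fin n) ℂ) (x : EuclideanSpace ℂ (Fin n)) :
    ‖Matrix.toEuclideanLin B x‖ ^ 2 = (star x.ofLp ⬝ᵥ (Bᴴ * B) *ᵥ x.ofLp).re := by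
  rw [← Matrix.mulVec_mulVec, Matrix.dotProduct_mulVec, ← Matrix.star_mulVec,
    EuclideanSpace.norm_sq_eq, dotProduct, Complex.re_sum]
  refine Finset.sum_congr rfl fun i _ => ?_
  simp [Matrix.toLpLin_apply, ← Complex.normSq_eq_norm_sq, Complex.normSq_apply]

lemma pab_normsq_one {n : ℕ} (x : EuclideanSpace ℂ (Fin n)) :
    ‖x‖ ^ 2 = (star x.ofLp ⬝ᵥ x.ofLp).re := by
  rw [EuclideanSpace.norm_sq_eq, dotProduct, Complex.re_sum]
  refine Finset.sum_congr rfl fun i _ => ?_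
  simp [← Complex.normSq_eq_norm_sq, Complex.normSq_apply]

lemma pab_sval_le {m n : ℕ} (A : Matrix (Fin m) (Fin n) ℂ) (x : EuclideanSpace ℂ (Fin n)) :
    sval A n * ‖x‖ ≤ ‖Matrix.toEuclideanLin A x‖ := by
  by_cases hx : x = 0
  · simp [hx]
  have hx' : 0 < ‖x‖ := norm_pos_iff.mpr hx
  rw [← le_div_iff₀ hx']
  refine csSup_le ⟨0, le_rfl, ⊤, by simp, by simp⟩ ?_
  rintro r ⟨_, V, hV, h⟩
  have : V = ⊤ := Submodule.eq_top_of_finrank_eq (by simpa using hV)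
  rw [le_div_iff₀ hx']
  exact h x (by simp [this])

lemma pab_le_sval {m n : ℕ} (hn : 1 ≤ n) (A : Matrix (Fin m) (Fin n) ℂ) (r : ℝ) (hr : 0 ≤ r)
    (h : ∀ x, r * ‖x‖ ≤ ‖Matrix.toEuclideanLin A x‖) : r ≤ sval A n := by
  refine le_csSup ?_ ⟨hr, ⊤, by simp, fun x _ => h x⟩
  set x : EuclideanSpace ℂ (Fin n) := EuclideanSpace.single ⟨0, hn⟩ 1 with hxd
  have hx : ‖x‖ = 1 := by simp [x]
  refine ⟨‖Matrix.toEuclideanLin A x‖, ?_⟩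
  rintro r ⟨_, V, hV, h⟩
  have : V = ⊤ := Submodule.eq_top_of_finrank_eq (by simpa using hV)
  simpa [hx] using h x (by simp [this])

lemma pab_sval_nonneg {m n : ℕ} (A : Matrix (Fin m) (Fin n) ℂ) (k : ℕ) : 0 ≤ sval A k :=
  Real.sSup_nonneg fun _ h => h.1

/-- Rayleigh bound from a bound on real eigenvalues. -/
lemma pab_rayleigh {N : ℕ} (H : Matrix (Fin N) (Fin N) ℂ) (hH : H.IsHermitian) (c : ℝ)
    (h : ∀ (ν : ℝ) (v : Fin N → ℂ), v ≠ 0 → H *ᵥ v = (ν : ℂ) • v → ν ≤ c) (x : Fin N → ℂ) :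
    (star x ⬝ᵥ H *ᵥ x).re ≤ c * (star x ⬝ᵥ x).re := by
  have hc : ((c : ℂ) • (1 : Matrix (Fin N) (Fin N) ℂ)).IsHermitian := by
    simp [Matrix.IsHermitian, Matrix.conjTranspose_smul]
  have hK : ((c : ℂ) • (1 : Matrix (Fin N) (Fin N) ℂ) - H).IsHermitian := hc.sub hH
  have hpsd : ((c : ℂ) • (1 : Matrix (Fin N) (Fin N) ℂ) - H).PosSemidef := by
    rw [hK.posSemidef_iff_eigenvalues_nonneg]
    intro i
    have h1 := hK.mulVec_eigenvectorBasis i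
    have h2 : (hK.eigenvectorBasis i).ofLp ≠ 0 := by
      intro h0
      have := hK.eigenvectorBasis.orthonormal.ne_zero i
      exact this (by ext j; simp [h0])
    have h3 := h (c - hK.eigenvalues i) _ h2 (by
      rw [Matrix.sub_mulVec, Matrix.smul_mulVec, Matrix.one_mulVec] at h1
      have h4 : (c : ℂ) • (hK.eigenvectorBasis i).ofLp - (hK.eigenvalues i) • (hK.eigenvectorBasis i).ofLp
        = H *ᵥ (hK.eigenvectorBasis i).ofLp := by
        rw [← h1]; abel
      rw [← h4]
      ext j
      simp [sub_mul])
    simp only [Pi.zero_apply]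
    linarith
  have h5 := hpsd.re_dotProduct_nonneg x
  rw [Matrix.sub_mulVec, Matrix.smul_mulVec, Matrix.one_mulVec, dotProduct_sub,
    dotProduct_smul] at h5
  simp at h5
  simpa using h5

/-- One half of Courant–Fischer for the top eigenbasis. -/
lemma pab_weyl {N S : ℕ} (H : Matrix (Fin N) (Fin N) ℂ) (hH : H.IsHermitian)
    (U : Matrix (Fin N) (Fin S) ℂ) (hU : Uᴴ * U = 1) (μ : Fin S → ℝ)
    (hT : H * U = U * Matrix.diagonal (fun i => (μ i : ℂ)))
    (hmax : ∀ (ν : ℝ) (v : Fin N → ℂ), v ≠ 0 → H.mulVec v = (ν : ℂ) • v →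
      Uᴴ.mulVec v = 0 → ∀ i, ν ≤ μ i)
    (A : Matrix (Fin N) (Fin S) ℂ) (hA : ∀ y, A *ᵥ y = 0 → y = 0) (c : ℝ)
    (hc : ∀ y, c * (star (A *ᵥ y) ⬝ᵥ A *ᵥ y).re ≤ (star (A *ᵥ y) ⬝ᵥ H *ᵥ (A *ᵥ y)).re)
    (i : Fin S) : c ≤ μ i := by
  set L : Matrix (Fin S) (Fin S) ℂ := Matrix.diagonal (fun j => ((μ j - μ i : ℝ) : ℂ)) with hL
  have hLh : Lᴴ = L := by
    rw [hL, Matrix.diagonal_conjTranspose]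
    congr 1; ext j; simp
  set H' := H - U * L * Uᴴ with hH'
  have hH'h : H'.IsHermitian := by
    rw [Matrix.IsHermitian, hH', Matrix.conjTranspose_sub, hH.eq]
    simp [Matrix.conjTranspose_mul, hLh, Matrix.mul_assoc]
  have hLe : Matrix.diagonal (fun j => (μ j : ℂ)) - L = (μ i : ℂ) • 1 := by
    ext a b
    by_cases hab : a = b
    · subst hab; simp [hL]
    · simp [hL, hab]
  have hH'U : H' * U = (μ i : ℂ) • U := by
    rw [hH', Matrix.sub_mul, hT, Matrix.mul_assoc (U * L), hU, Matrix.mul_one, ← Matrix.mul_sub,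
      hLe]
    simp
  have hUH' : Uᴴ * H' = (μ i : ℂ) • Uᴴ := by
    have := congrArg Matrix.conjTranspose hH'U
    rw [Matrix.conjTranspose_mul, hH'h.eq, Matrix.conjTranspose_smul] at this
    simpa using this
  have hray := pab_rayleigh H' hH'h (μ i) (by
    intro ν v hv hev
    by_contra hlt
    push Not at hlt
    have h1 : Uᴴ *ᵥ v = 0 := by
      have h2 : Uᴴ *ᵥ (H' *ᵥ v) = (ν : ℂ) • Uᴴ *ᵥ v := by rw [hev, Matrix.mulVec_smul]
      rw [Matrix.mulVec_mulVec, hUH', Matrix.smul_mulVec] at h2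
      have h3 : ((ν : ℂ) - (μ i : ℂ)) • Uᴴ *ᵥ v = 0 := by rw [sub_smul, h2, sub_self]
      rcases smul_eq_zero.mp h3 with h4 | h4
      · exfalso
        have : ν = μ i := by exact_mod_cast sub_eq_zero.mp h4
        linarith
      · exact h4
    have h5 : H *ᵥ v = (ν : ℂ) • v := by
      rw [← hev, hH', Matrix.sub_mulVec, ← Matrix.mulVec_mulVec, h1]
      simp
    exact absurd (hmax ν v hv h5 h1 i) (not_le.mpr hlt))
  obtain ⟨y, hy0, hy⟩ : ∃ y, y ≠ 0 ∧
      (Matrix.diagonal (fun j => if j = i then (0 : ℂ) else 1) * (Uᴴ * A)) *ᵥ y = 0 := by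
    rw [Matrix.exists_mulVec_eq_zero_iff, Matrix.det_mul, Matrix.det_diagonal,
      Finset.prod_eq_zero (Finset.mem_univ i) (by simp), zero_mul]
  have hz : L *ᵥ (Uᴴ *ᵥ (A *ᵥ y)) = 0 := by
    ext j
    have := congrFun hy j
    rw [← Matrix.mulVec_mulVec, Matrix.mulVec_diagonal, ← Matrix.mulVec_mulVec] at this
    rw [hL, Matrix.mulVec_diagonal]
    by_cases hj : j = i
    · subst hj; simp
    · simp only [hj, if_false, one_mul] at this
      rw [this]; simp
  have hHx : H *ᵥ (A *ᵥ y) = H' *ᵥ (A *ᵥ y) := by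
    rw [hH', Matrix.sub_mulVec, ← Matrix.mulVec_mulVec, ← Matrix.mulVec_mulVec, hz]
    simp
  have h1 := hc y
  rw [hHx] at h1
  have h2 := h1.trans (hray (A *ᵥ y))
  have hx0 : A *ᵥ y ≠ 0 := fun h => hy0 (hA y h)
  have hpos : 0 < (star (A *ᵥ y) ⬝ᵥ A *ᵥ y).re := by
    have := pab_normsq_one (WithLp.toLp 2 (A *ᵥ y))
    simp only at this
    rw [← this]
    have : WithLp.toLp 2 (A *ᵥ y) ≠ 0 := by simpa using hx0
    positivity
  exact le_of_mul_le_mul_right h2 hpos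

/-- Quadratic form bounded by the spectral norm. -/
lemma pab_quad_le {N : ℕ} (E : Matrix (Fin N) (Fin N) ℂ) (x : Fin N → ℂ) :
    (star x ⬝ᵥ E *ᵥ x).re ≤ ‖E‖ * (star x ⬝ᵥ x).re := by
  have h1 := pab_normsq_one (WithLp.toLp 2 x)
  simp only at h1
  rw [← h1]
  have h2 : star x ⬝ᵥ E *ᵥ x = inner ℂ (WithLp.toLp 2 x) (WithLp.toLp 2 (E *ᵥ x)) := by
    rw [EuclideanSpace.inner_eq_star_dotProduct, dotProduct_comm]
  rw [h2]
  calc _ ≤ ‖inner ℂ (WithLp.toLp 2 x) (WithLp.toLp 2 (E *ᵥ x))‖ := Complex.re_le_norm _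
    _ ≤ ‖WithLp.toLp 2 x‖ * ‖WithLp.toLp 2 (E *ᵥ x)‖ := norm_inner_le_norm _ _
    _ ≤ ‖WithLp.toLp 2 x‖ * (‖E‖ * ‖WithLp.toLp 2 x‖) := by
      gcongr
      exact Matrix.l2_opNorm_mulVec E (WithLp.toLp 2 x)
    _ = _ := by ring

lemma pab_norm_isometry_le {m n : ℕ} (U : Matrix (Fin m) (Fin n) ℂ) (hU : Uᴴ * U = 1) :
    ‖U‖ ≤ 1 := by
  have h := Matrix.l2_opNorm_conjTranspose_mul_self U
  rw [hU] at h
  have h1 : ‖(1 : Matrix (Fin n) (Fin n) ℂ)‖ ≤ 1 := by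
    rw [← Matrix.diagonal_one, Matrix.l2_opNorm_diagonal]
    exact (pi_norm_le_iff_of_nonneg zero_le_one).mpr (by simp)
  nlinarith [norm_nonneg U]

lemma pab_norm_proj_le {m : ℕ} (Q : Matrix (Fin m) (Fin m) ℂ) (hQ : Qᴴ * Q = Q) :
    ‖Q‖ ≤ 1 := by
  have h := Matrix.l2_opNorm_conjTranspose_mul_self Q
  rw [hQ] at h
  nlinarith [norm_nonneg Q]

/-- Rayleigh lower bound of `T` on the range of `A`. -/
lemma pab_T_lower {N S : ℕ} (A : Matrix (Fin N) (Fin S) ℂ) (p : Fin S → ℝ) (q s : ℝ)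
    (hq : 0 ≤ q) (hpq : ∀ i, q ≤ p i) (y : Fin S → ℂ) :
    (q * sval A S ^ 2 + s) * (star (A *ᵥ y) ⬝ᵥ A *ᵥ y).re ≤
      (star (A *ᵥ y) ⬝ᵥ (A * Matrix.diagonal (fun i => (p i : ℂ)) * Aᴴ + (s : ℂ) • 1) *ᵥ
        (A *ᵥ y)).re := by
  set x := A *ᵥ y with hx
  have hxx := pab_normsq_one (WithLp.toLp 2 x)
  simp only at hxx
  set w := Aᴴ *ᵥ x with hw
  have hww := pab_normsq_one (WithLp.toLp 2 w)
  have e1 : star x ⬝ᵥ (A * Matrix.diagonal (fun i => (p i : ℂ)) * Aᴴ + (s : ℂ) • 1) *ᵥ x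
      = star w ⬝ᵥ (Matrix.diagonal (fun i => (p i : ℂ))) *ᵥ w + (s : ℂ) * (star x ⬝ᵥ x) := by
    rw [Matrix.add_mulVec, dotProduct_add, ← Matrix.mulVec_mulVec, ← Matrix.mulVec_mulVec,
      Matrix.dotProduct_mulVec, Matrix.smul_mulVec, Matrix.one_mulVec, dotProduct_smul, hw,
      Matrix.star_mulVec Aᴴ, Matrix.conjTranspose_conjTranspose, smul_eq_mul]
  have e2 : q * ‖WithLp.toLp 2 w‖ ^ 2 ≤
      (star w ⬝ᵥ (Matrix.diagonal (fun i => (p i : ℂ))) *ᵥ w).re := by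
    rw [EuclideanSpace.norm_sq_eq, dotProduct, Complex.re_sum, Finset.mul_sum]
    refine Finset.sum_le_sum fun i _ => ?_
    have : (star w i * (Matrix.diagonal (fun i => (p i : ℂ)) *ᵥ w) i).re = p i * ‖w i‖ ^ 2 := by
      rw [Matrix.mulVec_diagonal, ← Complex.normSq_eq_norm_sq, Complex.normSq_apply]
      simp
      ring
    rw [this]
    exact mul_le_mul_of_nonneg_right (hpq i) (by positivity)
  have e3 : sval A S * ‖WithLp.toLp 2 x‖ ≤ ‖WithLp.toLp 2 w‖ := by
    have hs := pab_sval_nonneg A S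
    have f1 : sval A S * ‖WithLp.toLp 2 y‖ ≤ ‖WithLp.toLp 2 x‖ := pab_sval_le A (WithLp.toLp 2 y)
    have f2 : ‖WithLp.toLp 2 x‖ ^ 2 ≤ ‖WithLp.toLp 2 y‖ * ‖WithLp.toLp 2 w‖ := by
      rw [hxx]
      have g1 : star x ⬝ᵥ x = inner ℂ (WithLp.toLp 2 y) (WithLp.toLp 2 w) := by
        rw [EuclideanSpace.inner_eq_star_dotProduct, dotProduct_comm _ (star _)]
        simp only
        have g2 : star y ⬝ᵥ w = star (A *ᵥ y) ⬝ᵥ x := by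
          rw [hw, Matrix.dotProduct_mulVec, ← Matrix.star_mulVec]
        rw [g2]
      rw [g1]
      exact (Complex.re_le_norm _).trans (norm_inner_le_norm _ _)
    rcases (norm_nonneg (WithLp.toLp 2 x)).eq_or_lt with h0 | h0
    · rw [← h0]; simp
    · refine le_of_mul_le_mul_right ?_ h0
      calc sval A S * ‖WithLp.toLp 2 x‖ * ‖WithLp.toLp 2 x‖
          = sval A S * ‖WithLp.toLp 2 x‖ ^ 2 := by ring
        _ ≤ sval A S * (‖WithLp.toLp 2 y‖ * ‖WithLp.toLp 2 w‖) := by gcongr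
        _ = (sval A S * ‖WithLp.toLp 2 y‖) * ‖WithLp.toLp 2 w‖ := by ring
        _ ≤ ‖WithLp.toLp 2 x‖ * ‖WithLp.toLp 2 w‖ := by gcongr
        _ = _ := by ring
  have e4 : (sval A S * ‖WithLp.toLp 2 x‖) ^ 2 ≤ ‖WithLp.toLp 2 w‖ ^ 2 :=
    pow_le_pow_left₀ (mul_nonneg (pab_sval_nonneg A S) (norm_nonneg _)) e3 2
  rw [e1, Complex.add_re, Complex.re_ofReal_mul, ← hxx]
  nlinarith [mul_le_mul_of_nonneg_left e4 hq]

lemma pab_main {N S : ℕ} (hS : 1 ≤ S) (A : Matrix (Fin N) (Fin S) ℂ)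
    (p : Fin S → ℝ) (hp : ∀ i, 0 < p i) (σsq : ℝ) (hσ : 0 ≤ σsq)
    (That : Matrix (Fin N) (Fin N) ℂ) (hThat : That.IsHermitian)
    (T : Matrix (Fin N) (Fin N) ℂ)
    (hTdef : T = A * Matrix.diagonal (fun i => (p i : ℂ)) * Aᴴ + (σsq : ℂ) • 1)
    (hβ : 0 < (⨅ i, p i) * sval A S ^ 2 - σsq)
    (U Uh : Matrix (Fin N) (Fin S) ℂ) (hU : IsTopEigenbasis T U) (hUh : IsTopEigenbasis That Uh) :
    Real.sqrt (1 - sval (Uᴴ * Uh) S ^ 2) ≤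
      2 * ‖T - That‖ / ((⨅ i, p i) * sval A S ^ 2 - σsq) := by
  set E := T - That with hE
  set q := ⨅ i, p i with hq
  have hq0 : 0 ≤ q := Real.iInf_nonneg fun i => (hp i).le
  have hqp : ∀ i, q ≤ p i := fun i => ciInf_le (Set.finite_range p).bddBelow i
  set g := q * sval A S ^ 2 with hg
  set β := g - σsq with hβd
  have he0 : 0 ≤ ‖E‖ := norm_nonneg _
  rcases le_or_gt β (2 * ‖E‖) with hbig | hsmall
  · have h1 : 1 ≤ 2 * ‖E‖ / β := by rwa [le_div_iff₀ hβ, one_mul]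
    refine le_trans ?_ h1
    refine Real.sqrt_le_iff.mpr ⟨zero_le_one, ?_⟩
    nlinarith [sq_nonneg (sval (Uᴴ * Uh) S)]
  have hgpos : 0 < g := by linarith
  have hsv : 0 < sval A S := by
    rcases (pab_sval_nonneg A S).eq_or_lt with h | h
    · rw [hg, ← h] at hgpos; simp at hgpos
    · exact h
  have hA : ∀ y, A *ᵥ y = 0 → y = 0 := by
    intro y hy
    have h1 : sval A S * ‖WithLp.toLp 2 y‖ ≤ ‖WithLp.toLp 2 (A *ᵥ y)‖ :=
      pab_sval_le A (WithLp.toLp 2 y)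
    rw [hy] at h1
    simp only [WithLp.toLp_zero, norm_zero] at h1
    have h2 : ‖WithLp.toLp 2 y‖ = 0 := by nlinarith [norm_nonneg (WithLp.toLp 2 y)]
    simpa using h2
  obtain ⟨hUU, μ, hTU, hmax⟩ := hU
  obtain ⟨hUhU, μh, hTUh, hmaxh⟩ := hUh
  have hlow : ∀ y, (g + σsq) * (star (A *ᵥ y) ⬝ᵥ A *ᵥ y).re ≤
      (star (A *ᵥ y) ⬝ᵥ T *ᵥ (A *ᵥ y)).re := by
    intro y; rw [hTdef]; exact pab_T_lower A p q σsq hq0 hqp y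
  have hTh : T.IsHermitian := by
    rw [hTdef, Matrix.IsHermitian]
    simp [Matrix.conjTranspose_mul, Matrix.diagonal_conjTranspose, Matrix.mul_assoc,
      Matrix.conjTranspose_smul]
    congr 3; ext j; simp
  have hμ := pab_weyl T hTh U hUU μ hTU hmax A hA _ hlow
  have hμh := pab_weyl That hThat Uh hUhU μh hTUh hmaxh A hA (g + σsq - ‖E‖) (by
    intro y
    have h1 := pab_quad_le E (A *ᵥ y)
    rw [hE, Matrix.sub_mulVec, dotProduct_sub, Complex.sub_re, ← hE] at h1
    linarith [hlow y])
  -- the range of `U` is the range of `A`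
  have hA' : U * (Uᴴ * A) = A := by
    set B := Matrix.diagonal (fun i => (p i : ℂ)) * Aᴴ * U *
      Matrix.diagonal (fun i => ((μ i - σsq : ℝ) : ℂ)⁻¹) with hB
    have hAB : A * B = U := by
      have h1 : A * (Matrix.diagonal (fun i => (p i : ℂ)) * Aᴴ * U) =
          U * Matrix.diagonal (fun i => ((μ i - σsq : ℝ) : ℂ)) := by
        have h2 : A * (Matrix.diagonal (fun i => (p i : ℂ)) * Aᴴ * U) = T * U - (σsq : ℂ) • U := by
          rw [hTdef, Matrix.add_mul, Matrix.smul_mul, Matrix.one_mul, add_sub_cancel_right]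
          simp only [Matrix.mul_assoc]
        rw [h2, hTU]
        ext a b
        simp [Matrix.mul_diagonal]
        ring
      rw [hB, ← Matrix.mul_assoc, h1, Matrix.mul_assoc, Matrix.diagonal_mul_diagonal]
      have : (fun i => ((μ i - σsq : ℝ) : ℂ) * ((μ i - σsq : ℝ) : ℂ)⁻¹) = fun _ => 1 := by
        ext i
        apply mul_inv_cancel₀
        have := hμ i
        exact_mod_cast (by linarith : (0 : ℝ) < μ i - σsq).ne'
      rw [this, Matrix.diagonal_one, Matrix.mul_one]
    have h3 : (Uᴴ * A) * B = 1 := by rw [Matrix.mul_assoc, hAB, hUU]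
    have h4 : B * (Uᴴ * A) = 1 := mul_eq_one_comm.mp h3
    calc U * (Uᴴ * A) = A * (B * (Uᴴ * A)) := by rw [← Matrix.mul_assoc A, hAB]
      _ = A := by rw [h4, Matrix.mul_one]
  set Q : Matrix (Fin N) (Fin N) ℂ := 1 - U * Uᴴ with hQ
  have hQh : Qᴴ = Q := by simp [hQ]
  have hQQ : Q * Q = Q := by
    have : U * Uᴴ * (U * Uᴴ) = U * Uᴴ := by
      rw [Matrix.mul_assoc, ← Matrix.mul_assoc Uᴴ, hUU, Matrix.one_mul]
    rw [hQ, Matrix.sub_mul, Matrix.mul_sub, Matrix.mul_sub, this]; simp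
  have hQA : Q * A = 0 := by
    rw [hQ, Matrix.sub_mul, Matrix.mul_assoc, hA', Matrix.one_mul, sub_self]
  have hQT : Q * T = (σsq : ℂ) • Q := by
    rw [hTdef, Matrix.mul_add, ← Matrix.mul_assoc, ← Matrix.mul_assoc, hQA]
    simp
  set X := Q * Uh with hX
  set δ := g - ‖E‖ with hδ
  have hδpos : 0 < δ := by linarith
  set R : Matrix (Fin S) (Fin S) ℂ := Matrix.diagonal (fun i => ((μh i - σsq : ℝ) : ℂ)⁻¹) with hR
  have hXR : X = -(Q * E * Uh * R) := by
    have h1 : Q * E * Uh = -(X * Matrix.diagonal (fun i => ((μh i - σsq : ℝ) : ℂ))) := by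
      have h2 : Q * E * Uh = (σsq : ℂ) • X - X * Matrix.diagonal (fun i => (μh i : ℂ)) := by
        rw [hE, Matrix.mul_sub, Matrix.sub_mul, hQT, Matrix.mul_assoc Q That, hTUh,
          Matrix.smul_mul, ← Matrix.mul_assoc]
      rw [h2]
      ext a b
      simp [Matrix.mul_diagonal]
      ring
    rw [h1, Matrix.neg_mul, neg_neg, Matrix.mul_assoc, hR, Matrix.diagonal_mul_diagonal]
    have : (fun i => ((μh i - σsq : ℝ) : ℂ) * ((μh i - σsq : ℝ) : ℂ)⁻¹) = fun _ => 1 := by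
      ext i
      apply mul_inv_cancel₀
      have := hμh i
      exact_mod_cast (by linarith : (0 : ℝ) < μh i - σsq).ne'
    rw [this, Matrix.diagonal_one, Matrix.mul_one]
  have hRn : ‖R‖ ≤ δ⁻¹ := by
    rw [hR, Matrix.l2_opNorm_diagonal]
    refine (pi_norm_le_iff_of_nonneg (by positivity)).mpr fun i => ?_
    have h1 : δ ≤ μh i - σsq := by have := hμh i; linarith
    rw [norm_inv, Complex.norm_real, Real.norm_of_nonneg (by linarith)]
    exact inv_anti₀ hδpos h1
  have hXn : ‖X‖ ≤ 2 * ‖E‖ / β := by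
    have h1 : ‖X‖ ≤ ‖E‖ * δ⁻¹ := by
      rw [hXR, norm_neg]
      calc ‖Q * E * Uh * R‖ ≤ ‖Q * E * Uh‖ * ‖R‖ := Matrix.l2_opNorm_mul _ _
        _ ≤ (‖Q * E‖ * ‖Uh‖) * ‖R‖ := by gcongr; exact Matrix.l2_opNorm_mul _ _
        _ ≤ ((‖Q‖ * ‖E‖) * ‖Uh‖) * ‖R‖ := by gcongr; exact Matrix.l2_opNorm_mul _ _
        _ ≤ ((1 * ‖E‖) * 1) * δ⁻¹ := by
          gcongr
          · exact pab_norm_proj_le Q (by rw [hQh, hQQ])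
          · exact pab_norm_isometry_le Uh hUhU
        _ = _ := by ring
    refine h1.trans ?_
    rw [← div_eq_mul_inv, div_le_div_iff₀ hδpos hβ]
    nlinarith
  set s := 2 * ‖E‖ / β with hs
  have hs0 : 0 ≤ s := by positivity
  have hs1 : s < 1 := by rw [hs, div_lt_one hβ]; exact hsmall
  have hGX : (Uᴴ * Uh)ᴴ * (Uᴴ * Uh) = 1 - Xᴴ * X := by
    have h1 : Xᴴ * X = Uhᴴ * (Q * Uh) := by
      rw [hX, Matrix.conjTranspose_mul, hQh, Matrix.mul_assoc, ← Matrix.mul_assoc Q, hQQ]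
    rw [h1, hQ, Matrix.sub_mul, Matrix.mul_sub, Matrix.one_mul, hUhU]
    simp [Matrix.conjTranspose_mul, Matrix.mul_assoc]
  have hfin : Real.sqrt (1 - s ^ 2) ≤ sval (Uᴴ * Uh) S := by
    refine pab_le_sval hS _ _ (Real.sqrt_nonneg _) fun x => ?_
    refine (sq_le_sq₀ (by positivity) (norm_nonneg _)).mp ?_
    rw [mul_pow, Real.sq_sqrt (by nlinarith), pab_normsq, hGX, Matrix.sub_mulVec, dotProduct_sub,
      Complex.sub_re, Matrix.one_mulVec, ← pab_normsq, ← pab_normsq_one]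
    have h1 : ‖Matrix.toEuclideanLin X x‖ ≤ s * ‖x‖ :=
      (Matrix.l2_opNorm_mulVec X x).trans (by gcongr)
    have h2 := pow_le_pow_left₀ (norm_nonneg _) h1 2
    rw [mul_pow] at h2
    linarith
  have h6 := pow_le_pow_left₀ (Real.sqrt_nonneg _) hfin 2
  rw [Real.sq_sqrt (by nlinarith)] at h6
  exact Real.sqrt_le_iff.mpr ⟨hs0, by linarith⟩

end Helpers

/-- **Principal angle bound between signal subspaces** (Lemma 8, via Wedin's theorem):
if `σ_S(T) ≥ 2‖E‖₂` and `β = p_min σ_S(A)² − σ² > 0`, then the largest principal angle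
`ψ_S` between the top-`S` eigenspaces of `T` and `T̂` satisfies
`sin(ψ_S) = √(1 − σ_S(UᴴÛ)²) ≤ 2‖E‖₂/β`. -/
theorem principal_angle_bound_wedin {M S : ℕ} (hS : 1 ≤ S) (hSM : S ≤ M)
    (ω : Fin S → ℝ) (hω01 : ∀ i, ω i ∈ Set.Ico (0 : ℝ) 1) (hinj : Function.Injective ω)
    (p : Fin S → ℝ) (hp : ∀ i, 0 < p i) (σsq : ℝ) (hσ : 0 ≤ σsq)
    (That : Matrix (Fin (M + 1)) (Fin (M + 1)) ℂ) (hThat : That.IsHermitian) :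
    let A := vandermonde (M + 1) S ω
    let T := A * Matrix.diagonal (fun i => (p i : ℂ)) * Aᴴ + (σsq : ℂ) • 1
    let E := T - That
    let β := (⨅ i, p i) * sval A S ^ 2 - σsq
    2 * specNorm E ≤ sval T S → 0 < β →
    ∀ U Uh : Matrix (Fin (M + 1)) (Fin S) ℂ,
      IsTopEigenbasis T U → IsTopEigenbasis That Uh →
      Real.sqrt (1 - sval (Uᴴ * Uh) S ^ 2) ≤ 2 * specNorm E / β := by
  intro A T E β _ hβ U Uh hU hUh
  exact pab_main hS A p hp σsq hσ That hThat T rfl hβ U Uh hU hUh
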